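/- Let R = P/Q be a non-zero rational function, where P and Q are complex polynomials and Q has no real zeros, and let g(x) = R(x) e^{−πx²}. If α, β > 0 are such that αβ is rational and αβ ≤ 1, then the Gabor system G(g, α, β) is complete in L²(ℝ). -/

import Mathlib

open MeasureTheory Complex Real

/-- The Gabor system `G(g, α, β)` is complete in `L²(ℝ)`: the finite linear span of the
time-frequency shifts `x ↦ e^{2πiβlx} g(x − αk)`, `k, l ∈ ℤ`, is dense in `L²(ℝ, ℂ)`. -/
def GaborComplete (g : ℝ → ℂ) (α β : ℝ) : Prop :=
  (Submodule.span ℂ {h : Lp ℂ 2 (volume : Measure ℝ) |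
      ∃ k l : ℤ, ∀ᵐ x : ℝ, h x =
        Complex.exp (2 * Real.pi * Complex.I * (β * l * x)) * g (x - α * k)}).topologicalClosure
    = ⊤

open Filter Topology

lemma hasSum_of_forall_eq {ι : Type*} {f g : ι → ℂ} {s : ℂ} (hf : HasSum f s)
    (h : ∀ i, g i = f i) : HasSum g s :=
  (funext h : g = f) ▸ hf

lemma summable_exp_neg_mul_sq_add_abs {a : ℝ} (ha : 0 < a) (b : ℝ) :
    Summable fun n : ℤ => Real.exp (-a * (n : ℝ) ^ 2 + b * |(n : ℝ)|) := by
  refine (summable_pow_mul_jacobiTheta₂_term_bound (b / (2 * π)) (T := a / π)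
    (by positivity) 0).congr fun n => ?_
  rw [pow_zero, one_mul]
  congr 1
  push_cast
  field_simp
  ring

lemma summable_exp_neg_mul_sq_shift {a L : ℝ} (ha : 0 < a) (hL : L ≠ 0) {b : ℝ} (hb : 0 ≤ b)
    (y : ℝ) :
    Summable fun n : ℤ => Real.exp (-a * (y + L * n) ^ 2 + b * |y + L * n|) := by
  have hL2 : 0 < L ^ 2 := by positivity
  refine Summable.of_nonneg_of_le (fun n => (Real.exp_pos _).le) (fun n => ?_)
    ((summable_exp_neg_mul_sq_add_abs (a := a * L ^ 2) (by positivity)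
      (2 * a * |y| * |L| + b * |L|)).mul_left (Real.exp (b * |y|)))
  rw [← Real.exp_add]
  apply Real.exp_le_exp.mpr
  have h1 : |y + L * n| ≤ |y| + |L| * |(n : ℝ)| := by
    rw [← abs_mul]; exact abs_add_le _ _
  have h2 : -(|y| * |L| * |(n : ℝ)|) ≤ y * L * n := by
    rw [← abs_mul, ← abs_mul]; exact neg_abs_le _
  nlinarith [mul_le_mul_of_nonneg_left h1 hb, mul_le_mul_of_nonneg_left h2 ha.le,
    mul_nonneg ha.le (sq_nonneg y)]

/-- The Laurent polynomial in `exp (c * u)` that vanishes at the integers `u` with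
`0 < |u| ≤ M`. -/
noncomputable def expNodal (c : ℝ) (M : ℕ) (u : ℤ) : ℝ :=
  ∏ t ∈ Finset.range M,
    (1 - Real.exp (c * (u - (t + 1)))) * (1 - Real.exp (c * (-u - (t + 1))))

lemma expNodal_eq_zero (c : ℝ) {M : ℕ} {u : ℤ} (h0 : u ≠ 0) (hM : |u| ≤ M) :
    expNodal c M u = 0 := by
  rw [Int.abs_eq_natAbs] at hM
  apply Finset.prod_eq_zero (i := u.natAbs - 1)
  · rw [Finset.mem_range]; omega
  · have h : ((u.natAbs - 1 : ℕ) : ℝ) + 1 = |(u : ℝ)| := by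
      have : ((u.natAbs - 1 : ℕ) : ℤ) + 1 = |u| := by rw [Int.abs_eq_natAbs]; omega
      exact_mod_cast this
    rw [h]
    rcases abs_cases (u : ℝ) with ⟨h, -⟩ | ⟨h, -⟩ <;> simp [h]

lemma le_expNodal_zero {c : ℝ} (hc : 0 < c) (M : ℕ) :
    ((1 - Real.exp (-c)) ^ 2) ^ M ≤ expNodal c M 0 := by
  have h1 : 0 ≤ 1 - Real.exp (-c) := by simp [hc.le]
  unfold expNodal
  rw [← Finset.card_range M, ← Finset.prod_const, Finset.card_range]
  refine Finset.prod_le_prod (fun _ _ => by positivity) fun t _ => ?_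
  have h2 : Real.exp (c * (-(t + 1))) ≤ Real.exp (-c) := by
    apply Real.exp_le_exp.mpr
    nlinarith [mul_nonneg hc.le (Nat.cast_nonneg (α := ℝ) t)]
  simp only [Int.cast_zero, zero_sub, neg_zero]
  nlinarith

lemma abs_expNodal_le {c : ℝ} (hc : 0 < c) {M : ℕ} {u : ℤ} (hM : (M : ℤ) ≤ |u|) :
    |expNodal c M u| ≤ Real.exp (c * (M * |(u : ℝ)| - M * (M + 1) / 2)) := by
  induction M with
  | zero => simp [expNodal]
  | succ M ih =>
    have ih := ih (by push_cast at hM; omega)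
    have hs : (M : ℝ) + 1 ≤ |(u : ℝ)| := by exact_mod_cast hM
    have hfac : |(1 - Real.exp (c * (u - (M + 1)))) * (1 - Real.exp (c * (-u - (M + 1))))|
        ≤ Real.exp (c * (|(u : ℝ)| - (M + 1))) := by
      have key : ∀ v : ℝ, (M : ℝ) + 1 ≤ v →
          |(1 - Real.exp (c * (v - (M + 1)))) * (1 - Real.exp (c * (-v - (M + 1))))|
            ≤ Real.exp (c * (v - (M + 1))) := by
        intro v hv
        have hM0 : (0 : ℝ) ≤ M := Nat.cast_nonneg M
        have e1 : 1 ≤ Real.exp (c * (v - (M + 1))) :=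
          Real.one_le_exp (mul_nonneg hc.le (by linarith))
        have e2 : Real.exp (c * (-v - (M + 1))) ≤ 1 :=
          Real.exp_le_one_iff.mpr (mul_nonpos_of_nonneg_of_nonpos hc.le (by linarith))
        have e3 := Real.exp_pos (c * (-v - (M + 1)))
        rw [abs_mul, abs_of_nonpos (by linarith), abs_of_nonneg (by linarith)]
        nlinarith
      rcases abs_cases (u : ℝ) with ⟨h, -⟩ | ⟨h, -⟩
      · rw [h]; exact key _ (h ▸ hs)
      · rw [h]
        have := key _ (h ▸ hs)
        rwa [neg_neg, mul_comm] at this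
    rw [expNodal, Finset.prod_range_succ, abs_mul]
    refine (mul_le_mul ih hfac (abs_nonneg _) (Real.exp_pos _).le).trans_eq ?_
    rw [← Real.exp_add]
    congr 1
    push_cast
    ring

lemma hasSum_mul_expNodal {c : ℝ} {h : ℤ → ℂ}
    (hh : ∀ k : ℤ, HasSum (fun u : ℤ => h u * (Real.exp (c * (k * u)) : ℝ)) 0) (M : ℕ) (k : ℤ) :
    HasSum (fun u : ℤ => h u * (Real.exp (c * (k * u)) : ℝ) * (expNodal c M u : ℝ)) 0 := by
  induction M generalizing k with
  | zero => simpa [expNodal] using hh k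
  | succ M ih =>
    have e := (((ih k).mul_left (1 + (Real.exp (c * (-2 * (M + 1))) : ℂ))).sub
      ((ih (k + 1)).mul_left (Real.exp (c * (-(M + 1))) : ℂ))).sub
      ((ih (k - 1)).mul_left (Real.exp (c * (-(M + 1))) : ℂ))
    simp only [mul_zero, sub_zero] at e
    refine hasSum_of_forall_eq e fun u => ?_
    rw [show expNodal c (M + 1) u = expNodal c M u * _ from Finset.prod_range_succ _ _]
    have e1 : Real.exp (c * ((k + 1 : ℤ) * u)) = Real.exp (c * (k * u)) * Real.exp (c * u) := by
      rw [← Real.exp_add]; push_cast; ring_nf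
    have e2 : Real.exp (c * ((k - 1 : ℤ) * u)) = Real.exp (c * (k * u)) * Real.exp (-(c * u)) := by
      rw [← Real.exp_add]; push_cast; ring_nf
    have e3 : Real.exp (c * (u - (M + 1))) = Real.exp (c * u) * Real.exp (c * (-(M + 1))) := by
      rw [← Real.exp_add]; ring_nf
    have e4 : Real.exp (c * (-u - (M + 1))) = Real.exp (-(c * u)) * Real.exp (c * (-(M + 1))) := by
      rw [← Real.exp_add]; ring_nf
    have e5 : Real.exp (c * (-2 * (M + 1))) = Real.exp (c * (-(M + 1))) ^ 2 := by
      rw [sq, ← Real.exp_add]; ring_nf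
    have e6 : Real.exp (c * u) * Real.exp (-(c * u)) = 1 := by
      rw [← Real.exp_add]; simp
    have e6' : (Real.exp (c * u) : ℂ) * (Real.exp (-(c * u)) : ℂ) = 1 := by exact_mod_cast e6
    rw [e1, e2, e3, e4, e5]
    push_cast at e6' ⊢
    linear_combination (h u * cexp (c * (k * u)) * (expNodal c M u) *
      cexp (c * (-(M + 1))) ^ 2) * e6'

theorem eq_zero_of_hasSum_mul_gaussian {a : ℤ → ℂ} {C : ℝ} (ha : ∀ t, ‖a t‖ ≤ C) {α B : ℝ}
    (hα : 0 < α) (hαB : α < B)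
    (h : ∀ k : ℤ, HasSum (fun t : ℤ => a t * (Real.exp (-π * (t * B - k * α) ^ 2) : ℝ)) 0)
    (j : ℤ) : a j = 0 := by
  have hB : 0 < B := hα.trans hαB
  have hC : 0 ≤ C := (norm_nonneg _).trans (ha 0)
  set c : ℝ := 2 * π * B * α with hc_def
  have hc : 0 < c := by positivity
  set b : ℤ → ℂ := fun u => a (j + u) * (Real.exp (-π * B ^ 2 * (j + u) ^ 2) : ℝ) with hb_def
  have hb : ∀ k : ℤ, HasSum (fun u : ℤ => b u * (Real.exp (c * (k * u)) : ℝ)) 0 := by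
    intro k
    have h1 := ((Equiv.addLeft j).hasSum_iff.mpr (h k)).mul_left
      (Real.exp (π * k ^ 2 * α ^ 2 - c * k * j) : ℂ)
    rw [mul_zero] at h1
    refine hasSum_of_forall_eq h1 fun u => ?_
    simp only [hb_def, Function.comp, Equiv.coe_addLeft]
    rw [mul_assoc, ← Complex.ofReal_mul, mul_left_comm (Complex.ofReal _) (a _) (Complex.ofReal _),
      ← Complex.ofReal_mul, ← Real.exp_add, ← Real.exp_add]
    congr 3
    push_cast
    rw [hc_def]
    ring
  set κ : ℝ := 1 - Real.exp (-c) with hκ_def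
  have hκ : 0 < κ := by simp [hκ_def, hc]
  have hκ1 : κ ≤ 1 := by simp [hκ_def, (Real.exp_pos _).le]
  set K : ℝ := -Real.log (κ ^ 2) with hK_def
  have hK : 0 ≤ K := by
    rw [hK_def, neg_nonneg]
    exact Real.log_nonpos (by positivity) (pow_le_one₀ hκ.le hκ1)
  have hexpK : Real.exp (-K) = κ ^ 2 := by
    rw [hK_def, neg_neg, Real.exp_log (by positivity)]
  have hP0 : ∀ M : ℕ, Real.exp (-(K * M)) ≤ expNodal c M 0 := by
    intro M
    refine le_trans (le_of_eq ?_) (le_expNodal_zero hc M)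
    rw [← hκ_def, ← hexpK, ← Real.exp_nat_mul]
    ring_nf
  have hP0' : ∀ M : ℕ, 0 < expNodal c M 0 := fun M => (Real.exp_pos _).trans_le (hP0 M)
  have hsum : ∀ M : ℕ, ∑' u : ℤ, b u * (expNodal c M u / expNodal c M 0 : ℝ) = 0 := by
    intro M
    have h1 := (hasSum_mul_expNodal hb M 0).mul_right ((expNodal c M 0 : ℂ)⁻¹)
    rw [zero_mul] at h1
    rw [← h1.tsum_eq]
    refine tsum_congr fun u => ?_
    simp [div_eq_mul_inv, mul_assoc]
  have hlim := tendsto_tsum_of_dominated_convergence (𝓕 := atTop)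
    (f := fun (M : ℕ) (u : ℤ) => b u * (expNodal c M u / expNodal c M 0 : ℝ))
    (g := fun u => if u = 0 then b 0 else 0)
    (bound := fun u : ℤ => C * Real.exp (-(π * B * (B - α)) * (u : ℝ) ^ 2 +
      (2 * π * B ^ 2 * |(j : ℝ)| + K) * |(u : ℝ)|))
    ((summable_exp_neg_mul_sq_add_abs (mul_pos (by positivity) (sub_pos.mpr hαB)) _).mul_left C)
    ?_ ?_
  · simp only [hsum, tsum_ite_eq] at hlim
    have := tendsto_nhds_unique hlim tendsto_const_nhds
    simpa [hb_def] using this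
  · intro u
    by_cases hu : u = 0
    · subst hu
      simp [(hP0' _).ne']
    · simp only [hu, if_false]
      refine tendsto_const_nhds.congr' ?_
      filter_upwards [eventually_ge_atTop u.natAbs] with M hM
      rw [expNodal_eq_zero c hu (by rw [Int.abs_eq_natAbs]; exact_mod_cast hM)]
      simp
  · refine Eventually.of_forall fun M u => ?_
    have hbu : ‖b u‖ ≤ C * Real.exp (-π * B ^ 2 * (j + u) ^ 2) := by
      rw [hb_def, norm_mul, Complex.norm_real, Real.norm_of_nonneg (Real.exp_pos _).le]
      exact mul_le_mul_of_nonneg_right (ha _) (Real.exp_pos _).le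
    have hratio : ‖((expNodal c M u / expNodal c M 0 : ℝ) : ℂ)‖ ≤
        Real.exp (c * (u : ℝ) ^ 2 / 2 + K * |(u : ℝ)|) := by
      rw [Complex.norm_real, Real.norm_eq_abs, abs_div, abs_of_pos (hP0' M), div_le_iff₀ (hP0' M)]
      by_cases hMu : (M : ℤ) ≤ |u|
      · have hMu' : (M : ℝ) ≤ |(u : ℝ)| := by exact_mod_cast hMu
        refine (abs_expNodal_le hc hMu).trans (le_trans ?_
          (mul_le_mul_of_nonneg_left (hP0 M) (Real.exp_pos _).le))
        rw [← Real.exp_add]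
        apply Real.exp_le_exp.mpr
        have h1 : (M : ℝ) * |(u : ℝ)| - M * (M + 1) / 2 ≤ (u : ℝ) ^ 2 / 2 := by
          have := sq_abs (u : ℝ)
          nlinarith [sq_nonneg ((M : ℝ) - |(u : ℝ)|), Nat.cast_nonneg (α := ℝ) M]
        nlinarith [mul_le_mul_of_nonneg_left h1 hc.le, mul_le_mul_of_nonneg_left hMu' hK]
      · by_cases hu : u = 0
        · subst hu
          simp [abs_of_pos (hP0' M)]
        · rw [expNodal_eq_zero c hu (not_le.mp hMu).le, abs_zero]
          exact mul_nonneg (Real.exp_pos _).le (hP0' M).le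
    rw [norm_mul]
    refine (mul_le_mul hbu hratio (norm_nonneg _)
      (mul_nonneg hC (Real.exp_pos _).le)).trans ?_
    rw [mul_assoc, ← Real.exp_add]
    apply mul_le_mul_of_nonneg_left _ hC
    apply Real.exp_le_exp.mpr
    have h2 : -(|(j : ℝ)| * |(u : ℝ)|) ≤ j * u := by
      rw [← abs_mul]; exact neg_abs_le _
    have h3 := mul_le_mul_of_nonneg_left h2 (show 0 ≤ 2 * π * B ^ 2 by positivity)
    have h4 : 0 ≤ π * B ^ 2 * (j : ℝ) ^ 2 := by positivity
    rw [hc_def]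
    nlinarith

/-- Slow variation at `+∞` together with an exponential control of the translates. -/
def SlowlyVarying (F : ℝ → ℂ) : Prop :=
  ∃ κ : ℝ, 0 ≤ κ ∧ ∃ X : ℝ,
    (∀ x, X ≤ x → F x ≠ 0 ∧ ∀ y, ‖F (x + y)‖ ≤ Real.exp (κ * |y|) * ‖F x‖) ∧
    ∀ y, Tendsto (fun x => F (x + y) / F x) atTop (𝓝 1)

namespace SlowlyVarying

lemma const {c : ℂ} (hc : c ≠ 0) : SlowlyVarying fun _ => c :=
  ⟨0, le_rfl, 0, fun x _ => ⟨hc, fun y => by simp⟩, fun y => by simp [hc]⟩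

lemma mul {F G : ℝ → ℂ} (hF : SlowlyVarying F) (hG : SlowlyVarying G) :
    SlowlyVarying fun x => F x * G x := by
  obtain ⟨κ, hκ, X, h1, h2⟩ := hF
  obtain ⟨κ', hκ', X', h1', h2'⟩ := hG
  refine ⟨κ + κ', add_nonneg hκ hκ', max X X', fun x hx => ⟨?_, fun y => ?_⟩, fun y => ?_⟩
  · exact mul_ne_zero (h1 x (le_trans (le_max_left _ _) hx)).1
      (h1' x (le_trans (le_max_right _ _) hx)).1
  · rw [norm_mul, norm_mul, add_mul, Real.exp_add, mul_mul_mul_comm]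
    exact mul_le_mul ((h1 x (le_trans (le_max_left _ _) hx)).2 y)
      ((h1' x (le_trans (le_max_right _ _) hx)).2 y) (norm_nonneg _) (by positivity)
  · simpa [mul_div_mul_comm] using (h2 y).mul (h2' y)

lemma inv_of_bound {F : ℝ → ℂ} (hF : SlowlyVarying F) {κ : ℝ} (hκ : 0 ≤ κ)
    (h : ∀ u y, ‖F u‖ ≤ Real.exp (κ * |y|) * ‖F (u + y)‖) (hne : ∀ u, F u ≠ 0) :
    SlowlyVarying fun x => (F x)⁻¹ := by
  obtain ⟨-, -, X, -, h2⟩ := hF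
  refine ⟨κ, hκ, X, fun x _ => ⟨inv_ne_zero (hne x), fun y => ?_⟩, fun y => ?_⟩
  · rw [norm_inv, norm_inv, ← div_eq_mul_inv, inv_le_comm₀ (norm_pos_iff.mpr (hne _))
      (div_pos (Real.exp_pos _) (norm_pos_iff.mpr (hne _))), inv_div, div_le_iff₀ (Real.exp_pos _),
      mul_comm]
    exact h x y
  · have := (h2 y).inv₀ one_ne_zero
    simpa [inv_div_inv, div_eq_mul_inv, mul_comm] using this

lemma sub_const (z : ℂ) : SlowlyVarying fun x => (x : ℂ) - z := by
  have hnorm : ∀ x : ℝ, x - ‖z‖ ≤ ‖(x : ℂ) - z‖ := fun x => by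
    have := norm_sub_norm_le (x : ℂ) z
    rw [Complex.norm_real] at this
    exact (sub_le_sub_right (le_abs_self x) _).trans this
  refine ⟨1, zero_le_one, ‖z‖ + 1, fun x hx => ?_, fun y => ?_⟩
  · have h1 : 1 ≤ ‖(x : ℂ) - z‖ := by linarith [hnorm x]
    refine ⟨norm_pos_iff.mp (by linarith), fun y => ?_⟩
    calc ‖((x + y : ℝ) : ℂ) - z‖ = ‖((x : ℂ) - z) + (y : ℂ)‖ := by push_cast; ring_nf
      _ ≤ ‖(x : ℂ) - z‖ + |y| := by
        refine (norm_add_le _ _).trans_eq ?_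
        rw [Complex.norm_real, Real.norm_eq_abs]
      _ ≤ (1 * |y| + 1) * ‖(x : ℂ) - z‖ := by nlinarith [abs_nonneg y]
      _ ≤ _ := mul_le_mul_of_nonneg_right (Real.add_one_le_exp _) (norm_nonneg _)
  · have htop : Tendsto (fun x : ℝ => ‖(x : ℂ) - z‖) atTop atTop :=
      tendsto_atTop_mono hnorm (tendsto_atTop_add_const_right _ _ tendsto_id)
    have hinv : Tendsto (fun x : ℝ => ((x : ℂ) - z)⁻¹) atTop (𝓝 0) :=
      tendsto_inv₀_cobounded.comp (tendsto_norm_atTop_iff_cobounded.mp htop)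
    have h := (hinv.const_mul (y : ℂ)).const_add 1
    rw [mul_zero, add_zero] at h
    refine h.congr' ?_
    filter_upwards [htop.eventually_gt_atTop 0] with x hx
    have := norm_pos_iff.mp hx
    field_simp
    push_cast
    ring

lemma inv_sub_const {z : ℂ} (hz : ∀ x : ℝ, (x : ℂ) - z ≠ 0) :
    SlowlyVarying fun x => ((x : ℂ) - z)⁻¹ := by
  have him : 0 < |z.im| := by
    rw [abs_pos]
    intro h
    exact hz z.re (by apply Complex.ext <;> simp [h])
  refine (sub_const z).inv_of_bound (κ := |z.im|⁻¹) (by positivity) (fun u y => ?_) hz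
  have h1 : |z.im| ≤ ‖((u + y : ℝ) : ℂ) - z‖ := by
    have := Complex.abs_im_le_norm (((u + y : ℝ) : ℂ) - z)
    rwa [Complex.sub_im, Complex.ofReal_im, zero_sub, abs_neg] at this
  have h2 : |y| ≤ |z.im|⁻¹ * |y| * ‖((u + y : ℝ) : ℂ) - z‖ := by
    calc |y| = |z.im|⁻¹ * |y| * |z.im| := by field_simp
      _ ≤ _ := by gcongr
  calc ‖(u : ℂ) - z‖ = ‖(((u + y : ℝ) : ℂ) - z) - (y : ℂ)‖ := by push_cast; ring_nf
    _ ≤ ‖((u + y : ℝ) : ℂ) - z‖ + |y| := by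
      refine (norm_sub_le _ _).trans_eq ?_
      rw [Complex.norm_real, Real.norm_eq_abs]
    _ ≤ (|z.im|⁻¹ * |y| + 1) * ‖((u + y : ℝ) : ℂ) - z‖ := by linarith
    _ ≤ _ := mul_le_mul_of_nonneg_right (Real.add_one_le_exp _) (norm_nonneg _)

lemma eval_polynomial {P : Polynomial ℂ} (hP : P ≠ 0) :
    SlowlyVarying fun x => P.eval (x : ℂ) := by
  rw [(IsAlgClosed.splits P).eq_prod_roots]
  simp only [Polynomial.eval_mul, Polynomial.eval_C, Polynomial.eval_multiset_prod,
    Multiset.map_map]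
  refine (const (Polynomial.leadingCoeff_ne_zero.mpr hP)).mul ?_
  induction P.roots using Multiset.induction_on with
  | empty => simpa using const one_ne_zero
  | cons a s ih => simpa using (sub_const a).mul ih

lemma inv_eval_polynomial {Q : Polynomial ℂ} (hQ : ∀ x : ℝ, Q.eval (x : ℂ) ≠ 0) :
    SlowlyVarying fun x => (Q.eval (x : ℂ))⁻¹ := by
  have hQ0 : Q ≠ 0 := by
    rintro rfl
    simpa using hQ 0
  have hroots : ∀ z ∈ Q.roots, ∀ x : ℝ, (x : ℂ) - z ≠ 0 := by
    intro z hz x h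
    rw [sub_eq_zero] at h
    exact hQ x (h ▸ (Polynomial.mem_roots hQ0).mp hz)
  rw [(IsAlgClosed.splits Q).eq_prod_roots]
  simp only [Polynomial.eval_mul, Polynomial.eval_C, Polynomial.eval_multiset_prod,
    Multiset.map_map, mul_inv]
  refine (const (inv_ne_zero (Polynomial.leadingCoeff_ne_zero.mpr hQ0))).mul ?_
  generalize Q.roots = s at hroots
  induction s using Multiset.induction_on with
  | empty => simpa using const one_ne_zero
  | cons a s ih =>
    simpa [mul_comm] using (inv_sub_const (hroots a (Multiset.mem_cons_self _ _))).mul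
      (ih fun z hz => hroots z (Multiset.mem_cons_of_mem hz))

end SlowlyVarying

/-- An integrable function whose integrals against all continuous functions vanish is zero. -/
lemma ae_eq_zero_of_forall_integral_continuousMap_mul {X : Type*} [PseudoEMetricSpace X]
    [MeasurableSpace X] [BorelSpace X] {μ : Measure X} {f : X → ℂ} (hf : Integrable f μ)
    (h : ∀ u : C(X, ℂ), ∫ x, u x * f x ∂μ = 0) : f =ᵐ[μ] 0 := by
  refine ae_eq_zero_of_forall_setIntegral_isClosed_eq_zero hf fun s hs => ?_
  have hδ : ∀ n : ℕ, (0 : ℝ) < 1 / ((n : ℝ) + 1) := fun n => by positivity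
  let u : ℕ → X → ℂ := fun n x => ((thickenedIndicator (hδ n) s x : ℝ) : ℂ)
  have hu : ∀ n, Continuous (u n) := fun n =>
    Complex.continuous_ofReal.comp
      (NNReal.continuous_coe.comp (thickenedIndicator (hδ n) s).continuous)
  have hlim : Tendsto (fun n => ∫ x, u n x * f x ∂μ) atTop (𝓝 (∫ x, s.indicator f x ∂μ)) := by
    refine tendsto_integral_of_dominated_convergence (fun x => ‖f x‖)
      (fun n => (hu n).aestronglyMeasurable.mul hf.1) hf.norm
      (fun n => .of_forall fun x => ?_) (.of_forall fun x => ?_)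
    · rw [norm_mul, Complex.norm_real, Real.norm_eq_abs, NNReal.abs_eq]
      exact mul_le_of_le_one_left (norm_nonneg _) (by exact_mod_cast thickenedIndicator_le_one _ s x)
    · have h1 := tendsto_pi_nhds.mp (thickenedIndicator_tendsto_indicator_closure hδ
        tendsto_one_div_add_atTop_nhds_zero_nat s) x
      have h2 := ((Complex.continuous_ofReal.comp NNReal.continuous_coe).tendsto _).comp h1
      rw [hs.closure_eq] at h2
      have h3 : s.indicator f x =
          (ofReal ∘ NNReal.toReal) (s.indicator (fun _ => (1 : NNReal)) x) * f x := by
        by_cases hx : x ∈ s <;> simp [hx]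
      rw [h3]
      exact h2.mul_const (f x)
  have h0 : ∀ n, ∫ x, u n x * f x ∂μ = 0 := fun n => h ⟨u n, hu n⟩
  simp_rw [h0] at hlim
  rw [← integral_indicator hs.measurableSet]
  exact tendsto_nhds_unique hlim tendsto_const_nhds

lemma AddCircle.ae_eq_zero_of_fourierCoeff_eq_zero {T : ℝ} [hT : Fact (0 < T)]
    {f : AddCircle T → ℂ} (hf : Integrable f AddCircle.haarAddCircle)
    (h : ∀ n, fourierCoeff f n = 0) : f =ᵐ[AddCircle.haarAddCircle] 0 := by
  have hint : ∀ u : C(AddCircle T, ℂ), Integrable (fun x => u x * f x) AddCircle.haarAddCircle :=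
    fun u => hf.bdd_mul u.continuous.aestronglyMeasurable
      (.of_forall fun x => u.norm_coe_le_norm x)
  refine ae_eq_zero_of_forall_integral_continuousMap_mul hf fun u => ?_
  let L : C(AddCircle T, ℂ) →ₗ[ℂ] ℂ :=
    { toFun := fun u => ∫ x, u x * f x ∂AddCircle.haarAddCircle
      map_add' := fun u v => by
        simp_rw [ContinuousMap.add_apply, add_mul]
        exact integral_add (hint u) (hint v)
      map_smul' := fun c u => by
        simp only [ContinuousMap.smul_apply, smul_eq_mul, mul_assoc, integral_const_mul,
          RingHom.id_apply] }
  let L' : C(AddCircle T, ℂ) →L[ℂ] ℂ :=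
    L.mkContinuous (∫ x, ‖f x‖ ∂AddCircle.haarAddCircle) fun u => by
      refine (norm_integral_le_integral_norm _).trans ?_
      rw [← integral_mul_const]
      refine integral_mono (hint u).norm (hf.norm.mul_const _) fun x => ?_
      rw [norm_mul, mul_comm]
      exact mul_le_mul_of_nonneg_left (u.norm_coe_le_norm x) (norm_nonneg _)
  have hle : Submodule.span ℂ (Set.range (@fourier T)) ≤ LinearMap.ker (L' : _ →ₗ[ℂ] ℂ) := by
    rw [Submodule.span_le]
    rintro _ ⟨n, rfl⟩
    have := h (-n)
    rw [fourierCoeff, neg_neg] at this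
    exact this
  have hmem : u ∈ (Submodule.span ℂ (Set.range (@fourier T))).topologicalClosure := by
    rw [span_fourier_closure_eq_top]; trivial
  exact Submodule.topologicalClosure_minimal _ hle L'.isClosed_ker hmem

lemma ae_eq_zero_of_forall_setIntegral_exp_eq_zero {T : ℝ} (hT : 0 < T) (a : ℝ) {u : ℝ → ℂ}
    (hu : IntegrableOn u (Set.Ioc a (a + T)))
    (h : ∀ l : ℤ, ∫ x in Set.Ioc a (a + T),
      Complex.exp (2 * Real.pi * Complex.I * l * x / T) * u x = 0) :
    ∀ᵐ x ∂volume.restrict (Set.Ioc a (a + T)), u x = 0 := by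
  have : Fact (0 < T) := ⟨hT⟩
  have hL : MemLp (AddCircle.liftIoc T a u) 1 volume :=
    (memLp_one_iff_integrable.mpr hu).memLp_liftIoc
  have hI : Integrable (AddCircle.liftIoc T a u) AddCircle.haarAddCircle :=
    memLp_one_iff_integrable.mp hL.haarAddCircle
  have hz := AddCircle.ae_eq_zero_of_fourierCoeff_eq_zero hI fun n => by
    rw [fourierCoeff_liftIoc_eq, fourierCoeffOn_eq_integral, intervalIntegral.integral_of_le
      (by linarith)]
    have := h (-n)
    simp only [fourier_coe_apply, smul_eq_mul, add_sub_cancel_left]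
    rw [this, smul_zero]
  have hz' : ∀ᵐ y ∂(volume : Measure (AddCircle T)), AddCircle.liftIoc T a u y = 0 := by
    rw [AddCircle.volume_eq_smul_haarAddCircle]
    exact Measure.ae_smul_measure hz _
  have := (AddCircle.measurePreserving_mk T a).quasiMeasurePreserving.ae hz'
  filter_upwards [this, ae_restrict_mem measurableSet_Ioc] with x hx hm
  rwa [AddCircle.liftIoc_coe_apply hm] at hx

lemma AddCircle.integrable_fourierSeries_mul {T : ℝ} [hT : Fact (0 < T)] {γ : ℤ → ℂ}
    (hγ : Summable fun n => ‖γ n‖) {φ : AddCircle T → ℂ}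
    (hφ : Integrable φ AddCircle.haarAddCircle) :
    Integrable (fun t => (∑' n, γ n * fourier (-n) t) * φ t) AddCircle.haarAddCircle := by
  have hb : ∀ n t, ‖γ n * fourier (-n) (t : AddCircle T)‖ ≤ ‖γ n‖ := fun n t => by
    rw [norm_mul, fourier_apply, Circle.norm_coe, mul_one]
  refine hφ.bdd_mul (c := ∑' n, ‖γ n‖) ?_ (.of_forall fun t => tsum_of_norm_bounded hγ.hasSum fun n => hb n t)
  exact (continuous_tsum (fun n => by fun_prop) hγ hb).aestronglyMeasurable

lemma AddCircle.fourierCoeff_fourierSeries_mul {T : ℝ} [hT : Fact (0 < T)] {γ : ℤ → ℂ}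
    (hγ : Summable fun n => ‖γ n‖) {φ : AddCircle T → ℂ}
    (hφ : Integrable φ AddCircle.haarAddCircle) (m : ℤ) :
    fourierCoeff (fun t => (∑' n, γ n * fourier (-n) t) * φ t) m =
      ∑' n, γ n * fourierCoeff φ (m + n) := by
  have hn : ∀ n (t : AddCircle T), ‖fourier n t‖ = 1 := fun n t => by
    rw [fourier_apply, Circle.norm_coe]
  let F : ℤ → AddCircle T → ℂ := fun n t => γ n * (fourier (-(m + n)) t • φ t)
  have hF : ∀ n, Integrable (F n) AddCircle.haarAddCircle := fun n =>
    (hφ.bdd_mul (c := 1) (fourier (-(m + n))).continuous.aestronglyMeasurable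
      (.of_forall fun t => (hn _ t).le)).const_mul _
  have hF' : Summable fun n => ∫ t, ‖F n t‖ ∂AddCircle.haarAddCircle := by
    simp only [F, norm_mul, norm_smul, hn, one_mul, integral_const_mul]
    exact hγ.mul_right _
  have key := integral_tsum_of_summable_integral_norm hF hF'
  simp only [F, integral_const_mul] at key
  simp only [fourierCoeff, key]
  refine integral_congr_ae (.of_forall fun t => ?_)
  have hs : Summable fun n => γ n * fourier (-n) t := by
    refine Summable.of_norm (hγ.congr fun n => ?_)
    rw [norm_mul, hn, mul_one]
  simp only [smul_eq_mul]
  rw [← mul_assoc, mul_comm (fourier (-m) t), ← tsum_mul_right, ← tsum_mul_right]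
  refine tsum_congr fun n => ?_
  rw [neg_add, fourier_add]
  ring

lemma ae_ne_zero_of_differentiable {D : ℂ → ℂ} (hD : Differentiable ℂ D) {z₀ : ℂ}
    (h0 : D z₀ ≠ 0) : ∀ᵐ x : ℝ, D x ≠ 0 := by
  have hC : AnalyticOnNhd ℂ D Set.univ := fun z _ => hD.analyticAt z
  have hR : AnalyticOnNhd ℝ (fun x : ℝ => D x) Set.univ := fun x _ =>
    ((hD.analyticAt (x : ℂ)).restrictScalars (𝕜 := ℝ)).comp (Complex.ofRealCLM.analyticAt x)
  rcases hR.eqOn_zero_or_eventually_ne_zero_of_preconnected isPreconnected_univ with h | h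
  · refine absurd ?_ h0
    refine hC.eqOn_zero_of_preconnected_of_frequently_eq_zero isPreconnected_univ
      (Set.mem_univ 0) ?_ (Set.mem_univ z₀)
    have ht : Tendsto (fun x : ℝ => (x : ℂ)) (𝓝[≠] 0) (𝓝[≠] 0) := by
      refine tendsto_nhdsWithin_iff.mpr ⟨?_, ?_⟩
      · exact (Complex.continuous_ofReal.tendsto' 0 0 Complex.ofReal_zero).mono_left
          nhdsWithin_le_nhds
      · filter_upwards [self_mem_nhdsWithin] with x hx
        simpa using hx
    exact ht.frequently (Eventually.frequently (.of_forall fun x => h (Set.mem_univ x)))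
  · have := ae_restrict_le_codiscreteWithin (μ := volume) (MeasurableSet.univ : MeasurableSet (Set.univ : Set ℝ)) h
    rwa [Measure.restrict_univ] at this

lemma differentiable_tsum_exp {γ : ℤ → ℂ}
    (hγ : ∀ b : ℝ, Summable fun n : ℤ => ‖γ n‖ * Real.exp (b * |(n : ℝ)|)) :
    Differentiable ℂ fun ζ : ℂ => ∑' n : ℤ, γ n * Complex.exp (-(2 * π * I * n * ζ)) := by
  intro ζ
  have hd : DifferentiableOn ℂ
      (fun ζ : ℂ => ∑' n : ℤ, γ n * Complex.exp (-(2 * π * I * n * ζ)))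
      (Metric.ball 0 (‖ζ‖ + 1)) := by
    refine differentiableOn_tsum_of_summable_norm (hγ (2 * π * (‖ζ‖ + 1)))
      (fun n => by fun_prop) Metric.isOpen_ball fun n w hw => ?_
    rw [norm_mul]
    refine mul_le_mul_of_nonneg_left ?_ (norm_nonneg _)
    refine (Complex.norm_exp_le_exp_norm _).trans (Real.exp_le_exp.mpr ?_)
    rw [mem_ball_zero_iff] at hw
    rw [norm_neg]
    simp only [norm_mul, Complex.norm_ofNat, Complex.norm_real, Real.norm_eq_abs, Complex.norm_I,
      Complex.norm_intCast, abs_of_pos Real.pi_pos, mul_one]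
    rw [mul_assoc, mul_assoc, mul_comm |(n : ℝ)|, ← mul_assoc, ← mul_assoc]
    gcongr
  exact hd.differentiableAt (Metric.isOpen_ball.mem_nhds (by simp))

open Matrix in
/-- A finite family of square-summable sequences annihilated by correlations with superexponentially
decaying sequences vanishes if the associated entire matrix symbol is somewhere injective. -/
lemma eq_zero_of_tsum_correlation_eq_zero {ι σ : Type*} [Fintype ι] [Fintype σ] [DecidableEq σ]
    {c : σ → ℤ → ℂ} (hc : ∀ s, Memℓp (c s) 2) {γ : ι → σ → ℤ → ℂ}
    (hγ : ∀ r s (b : ℝ), Summable fun n : ℤ => ‖γ r s n‖ * Real.exp (b * |(n : ℝ)|))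
    (hcorr : ∀ r (m : ℤ), ∑ s, ∑' n, γ r s n * c s (m + n) = 0)
    {N : Matrix σ ι ℂ} {ζ₀ : ℂ}
    (hN : (N * Matrix.of fun r s =>
      ∑' n : ℤ, γ r s n * Complex.exp (-(2 * π * I * n * ζ₀))).det ≠ 0) (s : σ) (n : ℤ) :
    c s n = 0 := by
  have : Fact ((0 : ℝ) < 1) := ⟨one_pos⟩
  let φ : σ → Lp ℂ 2 (@AddCircle.haarAddCircle 1 _) := fun s =>
    fourierBasis.repr.symm ⟨c s, hc s⟩
  have hφc : ∀ s n, fourierCoeff (φ s) n = c s n := fun s n => by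
    rw [← fourierBasis_repr, LinearIsometryEquiv.apply_symm_apply]
  have hφ : ∀ s, Integrable (φ s) AddCircle.haarAddCircle := fun s =>
    (Lp.memLp (φ s)).integrable one_le_two
  have hγ0 : ∀ r s, Summable fun n => ‖γ r s n‖ := fun r s => by simpa using hγ r s 0
  let Γ : ℂ → Matrix ι σ ℂ := fun ζ => Matrix.of fun r s =>
    ∑' n : ℤ, γ r s n * Complex.exp (-(2 * π * I * n * ζ))
  have hΓ : ∀ r s (x : ℝ), Γ x r s = ∑' n, γ r s n * fourier (-n) (x : AddCircle (1 : ℝ)) := by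
    intro r s x
    refine tsum_congr fun n => ?_
    rw [fourier_coe_apply]
    congr 2
    push_cast
    ring
  have hzero : ∀ r, ∀ᵐ t ∂(@AddCircle.haarAddCircle (1 : ℝ) _),
      ∑ s, (∑' n, γ r s n * fourier (-n) t) * φ s t = 0 := by
    intro r
    have hint := fun s => AddCircle.integrable_fourierSeries_mul (hγ0 r s) (hφ s)
    refine AddCircle.ae_eq_zero_of_fourierCoeff_eq_zero
      (integrable_finsetSum _ fun s _ => hint s) fun m => ?_
    have h := congrFun (fourierCoeff.sum Finset.univ _ fun s _ => hint s) m
    simp only [Finset.sum_apply, AddCircle.fourierCoeff_fourierSeries_mul (hγ0 r _) (hφ _),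
      hφc, hcorr] at h
    rw [← h]
    congr 1
    funext t
    simp
  have hmk := (AddCircle.measurePreserving_mk (1 : ℝ) 0).quasiMeasurePreserving
  have hvol : (volume : Measure (AddCircle (1 : ℝ))) = AddCircle.haarAddCircle := by
    rw [AddCircle.volume_eq_smul_haarAddCircle]; simp
  rw [hvol] at hmk
  have hzero' := hmk.ae (ae_all_iff.mpr hzero)
  have hdet : ∀ᵐ x : ℝ, (N * Γ x).det ≠ 0 := by
    refine ae_ne_zero_of_differentiable (D := fun ζ => (N * Γ ζ).det) (fun ζ => ?_) hN
    simp only [Matrix.det_apply, Matrix.mul_apply]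
    have hd : ∀ r s, Differentiable ℂ fun ζ => Γ ζ r s := fun r s =>
      differentiable_tsum_exp (hγ r s)
    fun_prop
  have hφ0 : ∀ᵐ x : ℝ ∂volume.restrict (Set.Ioc (0 : ℝ) (0 + 1)),
      φ s (x : AddCircle (1 : ℝ)) = 0 := by
    filter_upwards [hzero', ae_restrict_of_ae hdet] with x hx hdx
    have hv : Γ x *ᵥ (fun s => φ s (x : AddCircle (1 : ℝ))) = 0 := by
      funext r
      simp only [Matrix.mulVec, dotProduct, hΓ]
      exact hx r
    have hw := Matrix.eq_zero_of_mulVec_eq_zero hdx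
      (v := fun s => φ s (x : AddCircle (1 : ℝ))) (by rw [← Matrix.mulVec_mulVec, hv, mulVec_zero])
    exact congrFun hw s
  rw [← hφc, fourierCoeff_eq_intervalIntegral _ _ 0,
    intervalIntegral.integral_of_le (by norm_num), integral_eq_zero_of_ae, smul_zero]
  filter_upwards [hφ0] with x hx
  simp [hx]

lemma Summable.hasSum_int_residues {f : ℤ → ℂ} (hf : Summable f) (p : ℕ) [NeZero p] :
    HasSum f (∑ s : Fin p, ∑' n : ℤ, f (n * p + (s : ℕ))) := by
  let e : Fin p × ℤ ≃ ℤ := (Equiv.prodComm _ _).trans (Int.divModEquiv p).symm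
  have h : ∑' x, f (e x) = ∑ s : Fin p, ∑' n : ℤ, f (n * p + (s : ℕ)) := by
    refine (((e.summable_iff (f := f)).mpr hf).tsum_prod).trans ?_
    rw [tsum_fintype]
    rfl
  rw [← h, e.tsum_eq f]
  exact hf.hasSum

lemma summable_exp_neg_pi_mul_sq {L : ℝ} (hL : L ≠ 0) (y : ℝ) :
    Summable fun n : ℤ => Real.exp (-π * (y + L * n) ^ 2) := by
  simpa using summable_exp_neg_mul_sq_shift Real.pi_pos hL le_rfl y

/-- The matrix of values of periodized Gaussians at the points of a rational lattice. -/
noncomputable def gaussianMatrix (α B : ℝ) (p q : ℕ) : Matrix (Fin q) (Fin p) ℂ :=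
  Matrix.of fun r s =>
    ∑' n : ℤ, ((Real.exp (-π * ((s * B - r * α) + p * B * n) ^ 2) : ℝ) : ℂ)

open Matrix in
lemma eq_zero_of_gaussianMatrix_mulVec_eq_zero {α B : ℝ} (hα : 0 < α) {p q : ℕ} (hp : p ≠ 0)
    (hpq : p.Coprime q) (hle : p ≤ q) (hB : q * α = p * B) {v : Fin p → ℂ}
    (hv : gaussianMatrix α B p q *ᵥ v = 0) : v = 0 := by
  have hp0 : (0 : ℝ) < p := by positivity
  have hq0 : (0 : ℝ) < q := by
    have : 0 < q := by omega
    positivity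
  have hB0 : 0 < B := by
    by_contra hB0
    nlinarith [mul_pos hq0 hα]
  have : NeZero p := ⟨hp⟩
  have hL : (p : ℝ) * B ≠ 0 := by positivity
  rcases hle.lt_or_eq with hlt | rfl
  · have hαB : α < B := by
      have : (p : ℝ) < q := by exact_mod_cast hlt
      by_contra! h
      nlinarith
    let a : ℤ → ℂ := fun t => v (Fin.ofNat p (t.natMod p))
    have ha : ∀ (n : ℤ) (s : Fin p), a (n * p + (s : ℕ)) = v s := fun n s => by
      have h2 := (Int.divModEquiv p).apply_symm_apply (n, s)
      exact congrArg (fun x => v x.2) h2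
    have hC : ∀ t, ‖a t‖ ≤ ∑ s, ‖v s‖ := fun t =>
      Finset.single_le_sum (f := fun s => ‖v s‖) (fun _ _ => norm_nonneg _) (Finset.mem_univ _)
    have hsum : ∀ k : ℤ, HasSum (fun t : ℤ => a t * (Real.exp (-π * (t * B - k * α) ^ 2) : ℝ)) 0 := by
      intro k
      have hs : Summable fun t : ℤ => a t * ((Real.exp (-π * (t * B - k * α) ^ 2) : ℝ) : ℂ) := by
        refine Summable.of_norm_bounded
          ((summable_exp_neg_pi_mul_sq hB0.ne' (-(k * α))).mul_left (∑ s, ‖v s‖)) fun t => ?_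
        rw [norm_mul, Complex.norm_real, Real.norm_eq_abs, Real.abs_exp,
          show (t : ℝ) * B - k * α = -(k * α) + B * t by ring]
        exact mul_le_mul_of_nonneg_right (hC t) (Real.exp_pos _).le
      convert hs.hasSum_int_residues p
      have hq : (0 : ℤ) < q := by omega
      have hr0 : 0 ≤ k % q := Int.emod_nonneg _ hq.ne'
      have hrq : k % q < q := Int.emod_lt_of_pos _ hq
      let r : Fin q := ⟨(k % q).toNat, by omega⟩
      have hk : (k : ℝ) = (r : ℕ) + q * (k / q : ℤ) := by
        have h1 : ((r : ℕ) : ℤ) = k % q := Int.toNat_of_nonneg hr0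
        have h2 := Int.emod_add_mul_ediv k q
        rw [← h1] at h2
        exact_mod_cast h2.symm
      have hvr := congrFun hv r
      simp only [Matrix.mulVec, dotProduct, Pi.zero_apply] at hvr
      rw [← hvr]
      refine Finset.sum_congr rfl fun s _ => ?_
      simp only [ha, tsum_mul_left]
      rw [mul_comm, gaussianMatrix, Matrix.of_apply]
      congr 1
      rw [← (Equiv.addRight (k / q : ℤ)).tsum_eq
        fun n : ℤ => ((Real.exp (-π * (((n * p + (s : ℕ) : ℤ) : ℝ) * B - k * α) ^ 2) : ℝ) : ℂ)]
      refine tsum_congr fun n => ?_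
      congr 4
      rw [Equiv.coe_addRight, hk]
      push_cast
      linear_combination (k / q : ℤ) * hB
    funext s
    have := eq_zero_of_hasSum_mul_gaussian hC hα hαB hsum ((0 : ℤ) * p + (s : ℕ))
    rwa [ha] at this
  · obtain rfl : p = 1 := by simpa using hpq
    have h := congrFun hv 0
    have hpos : gaussianMatrix α B 1 1 0 0 ≠ 0 := by
      rw [gaussianMatrix, Matrix.of_apply, ← Complex.ofReal_tsum, Complex.ofReal_ne_zero]
      exact ((summable_exp_neg_pi_mul_sq hL _).tsum_pos (fun n => (Real.exp_pos _).le) 0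
        (Real.exp_pos _)).ne'
    funext s
    obtain rfl := Subsingleton.elim s 0
    simpa [Matrix.mulVec, dotProduct, hpos] using h

open Matrix ComplexOrder in
lemma det_gaussianMatrix_ne_zero {α B : ℝ} (hα : 0 < α) {p q : ℕ} (hp : p ≠ 0)
    (hpq : p.Coprime q) (hle : p ≤ q) (hB : q * α = p * B) :
    ((gaussianMatrix α B p q)ᴴ * gaussianMatrix α B p q).det ≠ 0 := by
  intro h
  obtain ⟨v, hv0, hv⟩ := Matrix.exists_mulVec_eq_zero_iff.mpr h
  exact hv0 (eq_zero_of_gaussianMatrix_mulVec_eq_zero hα hp hpq hle hB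
    ((Matrix.conjTranspose_mul_self_mulVec_eq_zero _ _).mp hv))

lemma SlowlyVarying.tendsto_tsum {F : ℝ → ℂ} (hF : SlowlyVarying F) {L : ℝ} (hL : L ≠ 0) (y : ℝ) :
    Tendsto (fun x => ∑' n : ℤ, F (x + (y + L * n)) / F x *
      ((Real.exp (-π * (y + L * n) ^ 2) : ℝ) : ℂ)) atTop
      (𝓝 (∑' n : ℤ, ((Real.exp (-π * (y + L * n) ^ 2) : ℝ) : ℂ))) := by
  obtain ⟨κ, hκ, X, h1, h2⟩ := hF
  refine tendsto_tsum_of_dominated_convergence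
    (summable_exp_neg_mul_sq_shift Real.pi_pos hL hκ y) (fun n => ?_) ?_
  · have h := (h2 (y + L * n)).mul_const ((Real.exp (-π * (y + L * n) ^ 2) : ℝ) : ℂ)
    rwa [one_mul] at h
  · filter_upwards [eventually_ge_atTop X] with x hx n
    obtain ⟨h3, h4⟩ := h1 x hx
    rw [norm_mul, norm_div, Complex.norm_real, Real.norm_eq_abs, Real.abs_exp, add_comm (-π * _),
      Real.exp_add]
    refine mul_le_mul_of_nonneg_right ?_ (Real.exp_pos _).le
    rw [div_le_iff₀ (norm_pos_iff.mpr h3)]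
    exact h4 _

lemma SlowlyVarying.exists_norm_le {F : ℝ → ℂ} (hF : SlowlyVarying F) :
    ∃ κ C : ℝ, 0 ≤ κ ∧ 0 ≤ C ∧ ∀ x, ‖F x‖ ≤ C * Real.exp (κ * |x|) := by
  obtain ⟨κ, hκ, X, h1, -⟩ := hF
  refine ⟨κ, Real.exp (κ * |X|) * ‖F X‖, hκ, by positivity, fun x => ?_⟩
  have h := (h1 X le_rfl).2 (x - X)
  rw [add_sub_cancel] at h
  refine h.trans ?_
  rw [mul_right_comm, ← Real.exp_add, ← mul_add]
  gcongr
  rw [add_comm]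
  exact abs_sub _ _

lemma SlowlyVarying.summable_mul_gaussian {F : ℝ → ℂ} (hF : SlowlyVarying F) {L : ℝ} (hL : L ≠ 0)
    (y b : ℝ) :
    Summable fun n : ℤ => ‖F (y + L * n) * ((Real.exp (-π * (y + L * n) ^ 2) : ℝ) : ℂ)‖ *
      Real.exp (b * |(n : ℝ)|) := by
  obtain ⟨κ, C, hκ, hC, h⟩ := hF.exists_norm_le
  refine Summable.of_nonneg_of_le (fun n => by positivity) (fun n => ?_)
    ((summable_exp_neg_mul_sq_shift Real.pi_pos hL (b := κ + |b| / |L|) (by positivity) y).mul_left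
      (C * Real.exp (|b| * |y| / |L|)))
  have hn : |(n : ℝ)| ≤ |y + L * n| / |L| + |y| / |L| := by
    rw [← add_div, le_div_iff₀ (abs_pos.mpr hL), ← abs_mul]
    calc |(n : ℝ) * L| = |(y + L * n) - y| := by congr 1; ring
      _ ≤ _ := abs_sub _ _
  have hb : b * |(n : ℝ)| ≤ |b| * (|y + L * n| / |L| + |y| / |L|) :=
    (mul_le_mul_of_nonneg_right (le_abs_self b) (abs_nonneg _)).trans
      (mul_le_mul_of_nonneg_left hn (abs_nonneg _))
  rw [norm_mul, Complex.norm_real, Real.norm_eq_abs, Real.abs_exp]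
  calc _ ≤ C * Real.exp (κ * |y + L * n|) * Real.exp (-π * (y + L * n) ^ 2) *
        Real.exp (|b| * (|y + L * n| / |L| + |y| / |L|)) := by
        gcongr
        exact h _
    _ = _ := by
        rw [mul_assoc, mul_assoc, mul_assoc, ← Real.exp_add, ← Real.exp_add, ← Real.exp_add]
        congr 2
        ring

open Matrix in
/-- For large `x`, a square-summable sequence on the coset `x + Bℤ` which is orthogonal to all
samples of the translates of the window is zero. -/
lemma SlowlyVarying.eventually_eq_zero_of_tsum_eq_zero {F : ℝ → ℂ} (hF : SlowlyVarying F)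
    {g : ℝ → ℂ} (hg : ∀ x, g x = F x * ((Real.exp (-π * x ^ 2) : ℝ) : ℂ)) {α B : ℝ} (hα : 0 < α)
    {p q : ℕ} (hp : p ≠ 0) (hpq : p.Coprime q) (hle : p ≤ q) (hB : q * α = p * B) :
    ∀ᶠ x in atTop, ∀ c : ℤ → ℂ, Memℓp c 2 →
      (∀ k : ℤ, ∑' j : ℤ, c j * g (x + B * j - α * k) = 0) → ∀ j, c j = 0 := by
  have hp0 : (0 : ℝ) < p := by positivity
  have hB0 : B ≠ 0 := by
    rintro rfl
    have : 0 < q := by omega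
    have : 0 < (q : ℝ) * α := by positivity
    simp [hB] at this
  have hL : (p : ℝ) * B ≠ 0 := by positivity
  have : NeZero p := ⟨hp⟩
  have hgsum : ∀ {L : ℝ}, L ≠ 0 → ∀ y b : ℝ,
      Summable fun n : ℤ => ‖g (y + L * n)‖ * Real.exp (b * |(n : ℝ)|) := fun hL y b => by
    simp only [hg]
    exact hF.summable_mul_gaussian hL y b
  let E : ℝ → Matrix (Fin q) (Fin p) ℂ := fun x => Matrix.of fun r s =>
    ∑' n : ℤ, F (x + ((s * B - r * α) + p * B * n)) / F x *
      ((Real.exp (-π * ((s * B - r * α) + p * B * n) ^ 2) : ℝ) : ℂ)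
  have hE : Tendsto E atTop (𝓝 (gaussianMatrix α B p q)) :=
    tendsto_pi_nhds.mpr fun r => tendsto_pi_nhds.mpr fun s => hF.tendsto_tsum hL _
  have hdet : Tendsto (fun x => ((gaussianMatrix α B p q)ᴴ * E x).det) atTop
      (𝓝 ((gaussianMatrix α B p q)ᴴ * gaussianMatrix α B p q).det) :=
    ((continuous_const.matrix_mul continuous_id).matrix_det.tendsto _).comp hE
  have hev := hdet.eventually_ne (det_gaussianMatrix_ne_zero hα hp hpq hle hB)
  have hFne : ∀ᶠ x in atTop, F x ≠ 0 := by
    obtain ⟨_, _, X, h1, _⟩ := hF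
    filter_upwards [eventually_ge_atTop X] with x hx using (h1 x hx).1
  filter_upwards [hev, hFne] with x hx hFx c hc h j
  let d : Fin q → ℂ := fun r => Complex.exp (2 * π * x * (r * α))
  let d' : Fin p → ℂ := fun s => F x * Complex.exp (-π * x ^ 2 - 2 * π * x * (s * B))
  have hcb : ∀ j, ‖c j‖ ≤ ‖(⟨c, hc⟩ : lp (fun _ : ℤ => ℂ) 2)‖ := fun j =>
    lp.norm_apply_le_norm two_ne_zero (⟨c, hc⟩ : lp (fun _ : ℤ => ℂ) 2) j
  have hinj : ∀ s : Fin p, Function.Injective fun n : ℤ => n * (p : ℤ) + ((s : ℕ) : ℤ) :=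
    fun s a b hab => by simpa [hp] using hab
  have key := eq_zero_of_tsum_correlation_eq_zero
    (c := fun (s : Fin p) n => c (n * p + (s : ℕ)))
    (γ := fun (r : Fin q) (s : Fin p) n => g (x + (s * B - r * α) + p * B * n))
    (N := (gaussianMatrix α B p q)ᴴ * diagonal fun r => (d r)⁻¹)
    (ζ₀ := I * (x * (p * B)))
    (fun s => ?_) (fun r s b => hgsum hL _ b) (fun r m => ?_) ?_
    ((Int.divModEquiv p j).2) ((Int.divModEquiv p j).1)
  · have := (Int.divModEquiv p).symm_apply_apply j
    rwa [show c j = c ((Int.divModEquiv p).symm (Int.divModEquiv p j)) by rw [this]]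
  · have h2 := memℓp_gen_iff (p := 2) (by norm_num) |>.mp hc
    exact (memℓp_gen_iff (p := 2) (by norm_num)).mpr (h2.comp_injective (hinj s))
  · have hs : Summable fun j : ℤ => c j * g (x + B * j - α * ((r : ℕ) + q * m : ℤ)) := by
      have := hgsum hB0 (x - α * ((r : ℕ) + q * m : ℤ)) 0
      refine Summable.of_norm_bounded (this.mul_left
        ‖(⟨c, hc⟩ : lp (fun _ : ℤ => ℂ) 2)‖) fun j => ?_
      rw [norm_mul, zero_mul, Real.exp_zero, mul_one]
      refine mul_le_mul (hcb j) (le_of_eq ?_) (norm_nonneg _) (norm_nonneg _)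
      congr 2
      ring
    rw [← h ((r : ℕ) + q * m), (hs.hasSum_int_residues p).tsum_eq]
    refine Finset.sum_congr rfl fun s _ => ?_
    rw [← (Equiv.addLeft m).tsum_eq
      fun n : ℤ => c (n * p + (s : ℕ)) * g (x + B * (n * p + (s : ℕ) : ℤ) - α * ((r : ℕ) + q * m : ℤ))]
    refine tsum_congr fun n => ?_
    rw [mul_comm, Equiv.coe_addLeft]
    congr 2
    push_cast
    linear_combination (m : ℝ) * hB
  · have hΓ : (Matrix.of fun (r : Fin q) (s : Fin p) =>
        ∑' n : ℤ, g (x + (s * B - r * α) + p * B * n) *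
          Complex.exp (-(2 * π * I * n * (I * (x * (p * B)))))) =
        diagonal d * E x * diagonal d' := by
      ext r s
      rw [mul_diagonal, diagonal_mul]
      simp only [Matrix.of_apply, E]
      rw [← tsum_mul_left, ← tsum_mul_right]
      refine tsum_congr fun n => ?_
      have hexp : ((Real.exp (-π * (x + (s * B - r * α) + p * B * n) ^ 2) : ℝ) : ℂ) *
          Complex.exp (-(2 * π * I * n * (I * (x * (p * B))))) =
          Complex.exp (2 * π * x * (r * α)) *
            ((Real.exp (-π * ((s * B - r * α) + p * B * n) ^ 2) : ℝ) : ℂ) *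
            Complex.exp (-π * x ^ 2 - 2 * π * x * (s * B)) := by
        rw [Complex.ofReal_exp, Complex.ofReal_exp, ← Complex.exp_add, ← Complex.exp_add,
          ← Complex.exp_add]
        congr 1
        push_cast
        linear_combination (-2 * π * n * (x * (p * B)) : ℂ) * Complex.I_mul_I
      rw [hg, mul_assoc, hexp, add_assoc]
      simp only [d, d']
      field_simp
    rw [hΓ, Matrix.mul_assoc, Matrix.mul_assoc, ← Matrix.mul_assoc _ (diagonal d),
      diagonal_mul_diagonal]
    have hd : (fun r => (d r)⁻¹ * d r) = fun _ => 1 :=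
      funext fun r => inv_mul_cancel₀ (Complex.exp_ne_zero _)
    rw [hd, diagonal_one, Matrix.one_mul, ← Matrix.mul_assoc, det_mul, det_diagonal]
    exact mul_ne_zero hx (Finset.prod_ne_zero_iff.mpr fun s _ =>
      mul_ne_zero hFx (Complex.exp_ne_zero _))

lemma volume_eq_sum_map_restrict_Ioc {T : ℝ} (hT : 0 < T) (a : ℝ) :
    (volume : Measure ℝ) = Measure.sum fun n : ℤ =>
      (volume.restrict (Set.Ioc a (a + T))).map fun x => x + n * T := by
  have h : ∀ n : ℤ, (volume.restrict (Set.Ioc a (a + T))).map (fun x => x + n * T) =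
      volume.restrict (Set.Ioc (a + n • T) (a + (n + 1) • T)) := by
    intro n
    have h1 := (measurePreserving_add_right volume ((n : ℝ) * T)).restrict_preimage_emb
      (measurableEmbedding_addRight _) (Set.Ioc (a + n • T) (a + (n + 1) • T))
    rw [Set.preimage_add_const_Ioc] at h1
    rw [← h1.map_eq]
    simp only [zsmul_eq_mul, Int.cast_add, Int.cast_one, add_sub_cancel_right]
    congr 3
    ring
  simp_rw [h]
  rw [← Measure.restrict_iUnion (Set.pairwise_disjoint_Ioc_add_zsmul a T)
    fun _ => measurableSet_Ioc, iUnion_Ioc_add_zsmul hT, Measure.restrict_univ]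

lemma ae_iff_ae_restrict_Ioc {T : ℝ} (hT : 0 < T) (a : ℝ) {P : ℝ → Prop} :
    (∀ᵐ x, P x) ↔ ∀ᵐ x ∂volume.restrict (Set.Ioc a (a + T)), ∀ n : ℤ, P (x + n * T) := by
  rw [volume_eq_sum_map_restrict_Ioc hT a, Measure.ae_sum_iff, ae_all_iff,
    ← volume_eq_sum_map_restrict_Ioc hT a]
  exact forall_congr' fun n => (measurableEmbedding_addRight _).ae_map_iff

lemma lintegral_eq_tsum_setLIntegral_Ioc {T : ℝ} (hT : 0 < T) (a : ℝ) (f : ℝ → ENNReal) :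
    ∫⁻ x, f x = ∑' n : ℤ, ∫⁻ x in Set.Ioc a (a + T), f (x + n * T) := by
  conv_lhs => rw [volume_eq_sum_map_restrict_Ioc hT a]
  rw [lintegral_sum_measure]
  exact tsum_congr fun n => (measurableEmbedding_addRight _).lintegral_map _

lemma MeasureTheory.Integrable.hasSum_setIntegral_Ioc {E : Type*} [NormedAddCommGroup E]
    [NormedSpace ℝ E] {f : ℝ → E} (hf : Integrable f) {T : ℝ} (hT : 0 < T) (a : ℝ) :
    HasSum (fun n : ℤ => ∫ x in Set.Ioc a (a + T), f (x + n * T)) (∫ x, f x) := by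
  have hf' := hf
  rw [volume_eq_sum_map_restrict_Ioc hT a] at hf'
  have := hasSum_integral_measure hf'
  rw [← volume_eq_sum_map_restrict_Ioc hT a] at this
  convert this using 2 with n
  exact ((measurableEmbedding_addRight _).integral_map _).symm

lemma MeasureTheory.Integrable.lintegral_tsum_enorm_add_mul_lt_top {E : Type*}
    [NormedAddCommGroup E] {f : ℝ → E} (hf : Integrable f) {T : ℝ} (hT : 0 < T) (a : ℝ) :
    ∫⁻ x in Set.Ioc a (a + T), ∑' n : ℤ, ‖f (x + n * T)‖ₑ < ⊤ := by
  rw [lintegral_tsum fun n : ℤ => (hf.comp_add_right (n * T)).aestronglyMeasurable.enorm.restrict,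
    ← lintegral_eq_tsum_setLIntegral_Ioc hT a fun x => ‖f x‖ₑ]
  exact hf.2

lemma MeasureTheory.Integrable.ae_summable_norm_add_mul {E : Type*} [NormedAddCommGroup E]
    {f : ℝ → E} (hf : Integrable f) {T : ℝ} (hT : 0 < T) (a : ℝ) :
    ∀ᵐ x ∂volume.restrict (Set.Ioc a (a + T)), Summable fun n : ℤ => ‖f (x + n * T)‖ := by
  have hm : ∀ n : ℤ, AEMeasurable (fun x => ‖f (x + n * T)‖ₑ)
      (volume.restrict (Set.Ioc a (a + T))) := fun n =>
    (hf.comp_add_right (n * T)).aestronglyMeasurable.enorm.restrict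
  filter_upwards [ae_lt_top' (AEMeasurable.tsum hm)
    (hf.lintegral_tsum_enorm_add_mul_lt_top hT a).ne] with x hx
  simpa using ENNReal.summable_toReal hx.ne

/-- An integrable function with vanishing Fourier transform on a lattice has vanishing
periodization. -/
lemma ae_tsum_add_mul_eq_zero {T : ℝ} (hT : 0 < T) (a : ℝ) {f : ℝ → ℂ} (hf : Integrable f)
    (h : ∀ l : ℤ, ∫ x : ℝ, Complex.exp (2 * Real.pi * Complex.I * l * x / T) * f x = 0) :
    ∀ᵐ x ∂volume.restrict (Set.Ioc a (a + T)), ∑' n : ℤ, f (x + n * T) = 0 := by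
  have hint : ∀ n : ℤ, Integrable (fun x => f (x + n * T)) (volume.restrict (Set.Ioc a (a + T))) :=
    fun n => (hf.comp_add_right (n * T)).restrict
  have hsum : Summable fun n : ℤ => ∫ x in Set.Ioc a (a + T), ‖f (x + n * T)‖ :=
    (hf.norm.hasSum_setIntegral_Ioc hT a).summable
  have he : ∀ (l : ℤ) (x : ℝ), ‖Complex.exp (2 * π * I * l * x / T)‖ = 1 := fun l x => by
    rw [show (2 * π * I * l * x / T : ℂ) = (2 * π * l * x / T : ℝ) * I by push_cast; ring,
      Complex.norm_exp_ofReal_mul_I]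
  have hec : ∀ l : ℤ, Continuous fun x : ℝ => Complex.exp (2 * π * I * l * x / T) := fun l => by
    fun_prop
  refine ae_eq_zero_of_forall_setIntegral_exp_eq_zero hT a ?_ fun l => ?_
  · refine ⟨(AEMeasurable.tsum fun n => (hint n).1.aemeasurable).aestronglyMeasurable, ?_⟩
    exact (lintegral_mono fun x => enorm_tsum_le_tsum_enorm).trans_lt
      (hf.lintegral_tsum_enorm_add_mul_lt_top hT a)
  · have hF : ∀ n : ℤ, Integrable (fun x : ℝ => Complex.exp (2 * π * I * l * x / T) * f (x + n * T))
        (volume.restrict (Set.Ioc a (a + T))) := fun n =>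
      (hint n).bdd_mul (c := 1) (hec l).aestronglyMeasurable (.of_forall fun x => (he l x).le)
    have h1 := hasSum_integral_of_summable_integral_norm hF (by simpa [norm_mul, he] using hsum)
    have h2 : Integrable fun x : ℝ => Complex.exp (2 * π * I * l * x / T) * f x :=
      hf.bdd_mul (c := 1) (hec l).aestronglyMeasurable (.of_forall fun x => (he l x).le)
    have h3 := h2.hasSum_setIntegral_Ioc hT a
    rw [h l] at h3
    simp only [tsum_mul_left] at h1
    refine h1.unique (hasSum_of_forall_eq h3 fun n => ?_)
    congr 1
    funext x
    congr 1
    have hT' : (T : ℂ) ≠ 0 := Complex.ofReal_ne_zero.mpr hT.ne'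
    rw [Complex.exp_eq_exp_iff_exists_int]
    refine ⟨-(l * n), ?_⟩
    push_cast
    field_simp
    ring

lemma SlowlyVarying.memLp_two_mul_gaussian {F : ℝ → ℂ} (hF : SlowlyVarying F)
    (hm : Measurable F) :
    MemLp (fun x => F x * ((Real.exp (-π * x ^ 2) : ℝ) : ℂ)) 2 := by
  obtain ⟨κ, C, hκ, hC, h⟩ := hF.exists_norm_le
  have hG : MemLp (fun x : ℝ => C * Real.exp (κ ^ 2 / 4) * Real.exp (-1 * x ^ 2)) 2 := by
    refine MemLp.const_mul ?_ _
    refine (memLp_two_iff_integrable_sq_norm (by fun_prop)).mpr ?_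
    refine (integrable_exp_neg_mul_sq (b := 2) two_pos).congr (.of_forall fun x => ?_)
    simp only [Real.norm_eq_abs, Real.abs_exp]
    rw [← Real.exp_nat_mul]
    congr 1
    push_cast
    ring
  refine hG.mono (by fun_prop) (.of_forall fun x => ?_)
  rw [norm_mul, Complex.norm_real, Real.norm_eq_abs, Real.abs_exp, Real.norm_of_nonneg
    (by positivity)]
  calc _ ≤ C * Real.exp (κ * |x|) * Real.exp (-π * x ^ 2) := by
        gcongr
        exact h x
    _ ≤ _ := by
        rw [mul_assoc, mul_assoc, ← Real.exp_add, ← Real.exp_add]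
        refine mul_le_mul_of_nonneg_left (Real.exp_le_exp.mpr ?_) hC
        nlinarith [sq_nonneg (κ / 2 - |x|), sq_abs x, Real.pi_gt_three, sq_nonneg x]

/-- A window which is a slowly varying function times a Gaussian generates a complete Gabor system
on every rational lattice of density at least one. -/
lemma SlowlyVarying.gaborComplete {F : ℝ → ℂ} (hF : SlowlyVarying F) (hm : Measurable F)
    {g : ℝ → ℂ} (hg : ∀ x, g x = F x * ((Real.exp (-π * x ^ 2) : ℝ) : ℂ)) {α β : ℝ} (hα : 0 < α)
    (hβ : 0 < β) {p q : ℕ} (hp : p ≠ 0) (hpq : p.Coprime q) (hle : p ≤ q)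
    (hαβ : q * α = p * β⁻¹) : GaborComplete g α β := by
  have hB : 0 < β⁻¹ := inv_pos.mpr hβ
  have hg2 : MemLp g 2 := (funext hg : g = _) ▸ hF.memLp_two_mul_gaussian hm
  have hgk : ∀ k : ℤ, MemLp (fun x => g (x - α * k)) 2 := fun k =>
    hg2.comp_measurePreserving (measurePreserving_sub_right volume (α * k))
  have hgkl : ∀ k l : ℤ, MemLp (fun x : ℝ =>
      Complex.exp (2 * Real.pi * Complex.I * (β * l * x)) * g (x - α * k)) 2 := fun k l => by
    refine (hgk k).of_le ((Continuous.aestronglyMeasurable (by fun_prop)).mul (hgk k).1)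
      (.of_forall fun x => ?_)
    rw [norm_mul, show (2 * π * I * (β * l * x) : ℂ) = (2 * π * (β * l * x) : ℝ) * I by
      push_cast; ring, Complex.norm_exp_ofReal_mul_I, one_mul]
  rw [GaborComplete, Submodule.topologicalClosure_eq_top_iff, Submodule.eq_bot_iff]
  intro f hf
  have hf2 : MemLp (fun x => (starRingEnd ℂ) (f x)) 2 := (Lp.memLp f).star
  have horth : ∀ k l : ℤ, ∫ x : ℝ, Complex.exp (2 * π * I * l * x / (β⁻¹ : ℝ)) *
      ((starRingEnd ℂ) (f x) * g (x - α * k)) = 0 := by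
    intro k l
    have h := (Submodule.mem_orthogonal' _ _).mp hf ((hgkl k l).toLp _)
      (Submodule.subset_span ⟨k, l, (hgkl k l).coeFn_toLp⟩)
    rw [L2.inner_def] at h
    rw [← h]
    refine integral_congr_ae ?_
    filter_upwards [(hgkl k l).coeFn_toLp] with x hx
    rw [RCLike.inner_apply, hx, show (2 * π * I * l * x / (β⁻¹ : ℝ) : ℂ) =
      2 * π * I * (β * l * x) by push_cast; rw [div_inv_eq_mul]; ring]
    ring
  obtain ⟨X, hX⟩ := eventually_atTop.mp
    (hF.eventually_eq_zero_of_tsum_eq_zero hg hα hp hpq hle hαβ)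
  have hper : ∀ k : ℤ, ∀ᵐ x ∂volume.restrict (Set.Ioc X (X + β⁻¹)),
      ∑' n : ℤ, (starRingEnd ℂ) (f (x + n * β⁻¹)) * g (x + n * β⁻¹ - α * k) = 0 := fun k =>
    ae_tsum_add_mul_eq_zero hB X (hf2.integrable_mul (hgk k)) (horth k)
  have hsq : Integrable fun x => ‖f x‖ ^ 2 :=
    (memLp_two_iff_integrable_sq_norm (Lp.memLp f).1).mp (Lp.memLp f)
  rw [Lp.eq_zero_iff_ae_eq_zero]
  refine (ae_iff_ae_restrict_Ioc hB X (P := fun x => f x = 0)).mpr ?_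
  filter_upwards [ae_all_iff.mpr hper, hsq.ae_summable_norm_add_mul hB X,
    ae_restrict_mem measurableSet_Ioc] with x hx hs hm n
  have := hX x hm.1.le (fun n => (starRingEnd ℂ) (f (x + n * β⁻¹))) ?_ (fun k => ?_) n
  · simpa using this
  · refine (memℓp_gen_iff (p := 2) (by norm_num)).mpr ?_
    simpa using hs
  · simpa only [mul_comm] using hx k

theorem stmt_2 (P Q : Polynomial ℂ) (hP : P ≠ 0) (hQ : ∀ x : ℝ, Q.eval (x : ℂ) ≠ 0)
    (g : ℝ → ℂ)
    (hg : ∀ x : ℝ, g x = P.eval (x : ℂ) / Q.eval (x : ℂ) * Complex.exp (-(Real.pi) * x ^ 2))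
    (α β : ℝ) (hα : 0 < α) (hβ : 0 < β)
    (hrat : ∃ r : ℚ, α * β = (r : ℝ)) (hle : α * β ≤ 1) :
    GaborComplete g α β := by
  obtain ⟨r, hr⟩ := hrat
  have hr0 : 0 < r := by exact_mod_cast hr ▸ mul_pos hα hβ
  have hr1 : r ≤ 1 := by exact_mod_cast hr ▸ hle
  have hF : SlowlyVarying fun x => P.eval (x : ℂ) * (Q.eval (x : ℂ))⁻¹ :=
    (SlowlyVarying.eval_polynomial hP).mul (SlowlyVarying.inv_eval_polynomial hQ)
  have hnum : ((r.num.natAbs : ℕ) : ℤ) = r.num := Int.natAbs_of_nonneg (Rat.num_nonneg.mpr hr0.le)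
  refine hF.gaborComplete (p := r.num.natAbs) (q := r.den) ?_ (fun x => ?_) hα hβ ?_ r.reduced ?_ ?_
  · exact ((P.continuous.comp Complex.continuous_ofReal).mul
      ((Q.continuous.comp Complex.continuous_ofReal).inv₀ hQ)).measurable
  · rw [hg, div_eq_mul_inv]
    push_cast
    rfl
  · simpa using hr0.ne'
  · have := Rat.num_le_denom_iff.mpr hr1
    omega
  · have hden : (r.den : ℝ) ≠ 0 := by exact_mod_cast r.den_nz
    have hr' : α * β = r.num / r.den := by rw [hr, Rat.cast_def]
    have hn' : (r.num.natAbs : ℝ) = r.num := by rw [← Int.cast_natCast, hnum]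
    rw [hn']
    field_simp at hr' ⊢
    linarith
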